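/- Let {X_n}_{n≥1} be a symmetric two-state correlated random walk on {1,-1} with parameter 0<p<1 (i.e., p=q), started from the stationary distribution (1/2,1/2). Let A,B be positive integers, S_n = X_1+···+X_n, and τ = inf{k : S_k = A or S_k = -B}. Then E(τ) = A·B·(1-p)/p + (A+B)·(2p-1)/(2p). -/

import Mathlib

open MeasureTheory ProbabilityTheory Set

noncomputable section

variable {Ω : Type*} [MeasurableSpace Ω]

/-- The σ-algebra `σ(X_1, …, X_n)` generated by the first `n` steps of the process. -/
def sigmaUpTo (X : ℕ → Ω → ℝ) (n : ℕ) : MeasurableSpace Ω :=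
  ⨆ i ∈ Finset.Icc 1 n, MeasurableSpace.comap (X i) inferInstance

/-- The transition kernel of a two-state correlated random walk on `{1, -1}`:
from state `1` go to `1` with probability `p`; from state `-1` go to `-1`
with probability `q`. -/
def crwKernel (p q : ℝ) (i j : ℝ) : ℝ :=
  if i = 1 then (if j = 1 then p else 1 - p)
  else (if j = -1 then q else 1 - q)

/-- `X` is a two-state correlated random walk on `{1, -1}` with parameters `p, q`,
started from the stationary distribution `((1-q)/(2-p-q), (1-p)/(2-p-q))`:
each `X n` (for `n ≥ 1`) is measurable with values in `{1, -1}`, the initial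
distribution is stationary, and the Markov property with the prescribed
time-homogeneous transition probabilities holds, conditionally on
`F n = σ(X_1, …, X_n)`. -/
def IsCRW (μ : Measure Ω) (X : ℕ → Ω → ℝ) (p q : ℝ) : Prop :=
  (∀ i, 1 ≤ i → Measurable (X i)) ∧
  (∀ n, 1 ≤ n → ∀ ω, X n ω = 1 ∨ X n ω = -1) ∧
  (μ {ω | X 1 ω = 1} = ENNReal.ofReal ((1 - q) / (2 - p - q))) ∧
  (∀ n, 1 ≤ n → ∀ i ∈ ({1, -1} : Set ℝ), ∀ j ∈ ({1, -1} : Set ℝ),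
    ∀ E : Set Ω, MeasurableSet[sigmaUpTo X n] E →
      μ (E ∩ {ω | X n ω = i ∧ X (n + 1) ω = j})
        = ENNReal.ofReal (crwKernel p q i j) * μ (E ∩ {ω | X n ω = i}))

lemma sigmaUpTo_le {X : ℕ → Ω → ℝ} (hX : ∀ i, 1 ≤ i → Measurable (X i)) (n : ℕ) :
    sigmaUpTo X n ≤ (inferInstance : MeasurableSpace Ω) := by
  refine iSup₂_le fun i hi => ?_
  exact (hX i (Finset.mem_Icc.1 hi).1).comap_le

lemma measurable_sigmaUpTo {α : Type*} (X : ℕ → α → ℝ) {i n : ℕ} (hi : 1 ≤ i) (hin : i ≤ n) :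
    Measurable[sigmaUpTo X n] (X i) := by
  refine measurable_iff_comap_le.2 ?_
  exact le_iSup₂_of_le (f := fun i (_ : i ∈ Finset.Icc 1 n) =>
    MeasurableSpace.comap (X i) inferInstance) i (Finset.mem_Icc.2 ⟨hi, hin⟩) le_rfl

lemma measurable_sum_sigmaUpTo {α : Type*} (X : ℕ → α → ℝ) {k n : ℕ} (hkn : k ≤ n) :
    Measurable[sigmaUpTo X n] (fun ω => ∑ i ∈ Finset.Icc 1 k, X i ω) := by
  refine Finset.measurable_fun_sum _ fun i hi => ?_
  obtain ⟨h1, h2⟩ := Finset.mem_Icc.1 hi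
  exact measurable_sigmaUpTo X h1 (h2.trans hkn)

lemma crwKernel_nonneg {p q : ℝ} (hp0 : 0 ≤ p) (hp1 : p ≤ 1) (hq0 : 0 ≤ q) (hq1 : q ≤ 1)
    (i j : ℝ) : 0 ≤ crwKernel p q i j := by
  unfold crwKernel
  split_ifs <;> linarith

/-- The Markov property of a correlated random walk, tested against functions of the past. -/
lemma IsCRW.setIntegral_transition {μ : Measure Ω} {X : ℕ → Ω → ℝ} {p q : ℝ}
    (hX : IsCRW μ X p q) (hp0 : 0 ≤ p) (hp1 : p ≤ 1) (hq0 : 0 ≤ q) (hq1 : q ≤ 1)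
    {n : ℕ} (hn : 1 ≤ n) {i j : ℝ} (hi : i = 1 ∨ i = -1) (hj : j = 1 ∨ j = -1)
    {f : Ω → ℝ} (hf : Measurable[sigmaUpTo X n] f) :
    ∫ ω in {ω | X n ω = i ∧ X (n + 1) ω = j}, f ω ∂μ
      = crwKernel p q i j * ∫ ω in {ω | X n ω = i}, f ω ∂μ := by
  have hle := sigmaUpTo_le hX.1 n
  have htrim : (μ.restrict {ω | X n ω = i ∧ X (n + 1) ω = j}).trim hle
      = ENNReal.ofReal (crwKernel p q i j) • (μ.restrict {ω | X n ω = i}).trim hle := by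
    refine @Measure.ext _ (sigmaUpTo X n) _ _ fun E hE => ?_
    rw [Measure.smul_apply, trim_measurableSet_eq hle hE, trim_measurableSet_eq hle hE,
      Measure.restrict_apply (hle _ hE), Measure.restrict_apply (hle _ hE), smul_eq_mul]
    exact hX.2.2.2 n hn i (by simpa using hi) j (by simpa using hj) E hE
  rw [integral_trim hle hf.stronglyMeasurable, integral_trim hle hf.stronglyMeasurable, htrim,
    integral_smul_measure, ENNReal.toReal_ofReal (crwKernel_nonneg hp0 hp1 hq0 hq1 i j),
    smul_eq_mul]

/-- Splitting an integral according to the value of a `{1, -1}`-valued function. -/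
lemma integral_eq_add_setIntegral_of_sign {μ : Measure Ω} {Y f : Ω → ℝ} (hY : Measurable Y)
    (hYv : ∀ ω, Y ω = 1 ∨ Y ω = -1) (hf : Integrable f μ) :
    ∫ ω, f ω ∂μ = ∫ ω in {ω | Y ω = 1}, f ω ∂μ + ∫ ω in {ω | Y ω = -1}, f ω ∂μ := by
  have hs : MeasurableSet {ω | Y ω = 1} := hY (measurableSet_singleton 1)
  have hc : {ω | Y ω = -1} = {ω | Y ω = 1}ᶜ := by
    ext ω
    simp only [mem_ofPred_eq, mem_compl_iff]
    rcases hYv ω with h | h <;> rw [h] <;> norm_num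
  rw [hc, integral_add_compl hs hf]

/-- One step of a symmetric correlated random walk: the conditional expectation of
`f X_n X_{n+1}` given the past, where `f` may depend on the past. -/
lemma IsCRW.integral_step {μ : Measure Ω} {X : ℕ → Ω → ℝ} {p : ℝ}
    (hX : IsCRW μ X p p) (hp0 : 0 ≤ p) (hp1 : p ≤ 1) {n : ℕ} (hn : 1 ≤ n)
    {f : ℝ → Ω → ℝ} (hf : ∀ j, Measurable[sigmaUpTo X n] (f j))
    (hfi : ∀ j, Integrable (f j) μ) (hfX : Integrable (fun ω => f (X (n + 1) ω) ω) μ) :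
    ∫ ω, f (X (n + 1) ω) ω ∂μ = ∫ ω, (p * f (X n ω) ω + (1 - p) * f (-X n ω) ω) ∂μ := by
  have hXn := hX.1 n hn
  have hXn' := hX.1 (n + 1) (by omega)
  have hval := hX.2.1 n hn
  have hval' := hX.2.1 (n + 1) (by omega)
  have hset (i : ℝ) : MeasurableSet {ω | X n ω = i} := hXn (measurableSet_singleton i)
  have hset' (i : ℝ) : MeasurableSet {ω | X (n + 1) ω = i} := hXn' (measurableSet_singleton i)
  have hrestr (i j : ℝ) (hi : i = 1 ∨ i = -1) (hj : j = 1 ∨ j = -1) :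
      ∫ ω in {ω | X (n + 1) ω = j}, f (X (n + 1) ω) ω ∂(μ.restrict {ω | X n ω = i})
        = crwKernel p p i j * ∫ ω in {ω | X n ω = i}, f j ω ∂μ := by
    rw [← hX.setIntegral_transition hp0 hp1 hp0 hp1 hn hi hj (hf j),
      setIntegral_congr_fun (g := f j) (hset' j) (fun ω hω => by
        simp only [mem_ofPred_eq] at hω
        simp only [hω]), Measure.restrict_restrict (hset' j)]
    congr 2
    ext ω
    simp [and_comm]
  have hneg : Integrable (fun ω => p * f (X n ω) ω + (1 - p) * f (-X n ω) ω) μ := by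
    have hsum (j : ℝ) : (fun ω => f (j * X n ω) ω) = fun ω =>
        {ω | X n ω = 1}.indicator (f j) ω + {ω | X n ω = -1}.indicator (f (-j)) ω := by
      funext ω
      rcases hval ω with h | h <;> simp [indicator, h] <;> norm_num
    have hint (j : ℝ) : Integrable (fun ω => f (j * X n ω) ω) μ := by
      rw [hsum]
      exact ((hfi j).indicator (hset 1)).add ((hfi (-j)).indicator (hset (-1)))
    have h1 := hint 1
    have h2 := hint (-1)
    simp only [one_mul, neg_one_mul] at h1 h2
    exact (h1.const_mul p).add (h2.const_mul (1 - p))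
  have hstep (i : ℝ) (hi : i = 1 ∨ i = -1) :
      ∫ ω in {ω | X n ω = i}, (p * f (X n ω) ω + (1 - p) * f (-X n ω) ω) ∂μ
        = p * ∫ ω in {ω | X n ω = i}, f i ω ∂μ
          + (1 - p) * ∫ ω in {ω | X n ω = i}, f (-i) ω ∂μ := by
    rw [setIntegral_congr_fun (g := fun ω => p * f i ω + (1 - p) * f (-i) ω) (hset i)
      (fun ω hω => by
        simp only [mem_ofPred_eq] at hω
        simp only [hω]),
      integral_add ((hfi _).restrict.const_mul _) ((hfi _).restrict.const_mul _),
      integral_const_mul, integral_const_mul]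
  rw [integral_eq_add_setIntegral_of_sign hXn hval hfX,
    integral_eq_add_setIntegral_of_sign hXn' hval' hfX.restrict,
    integral_eq_add_setIntegral_of_sign hXn' hval' hfX.restrict,
    integral_eq_add_setIntegral_of_sign hXn hval hneg,
    hrestr 1 1 (by simp) (by simp), hrestr 1 (-1) (by simp) (by simp),
    hrestr (-1) 1 (by simp) (by simp), hrestr (-1) (-1) (by simp) (by simp),
    hstep 1 (by simp), hstep (-1) (by simp)]
  have h : (-1 : ℝ) ≠ 1 := by norm_num
  have h' : (1 : ℝ) ≠ -1 := by norm_num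
  simp only [crwKernel, if_true, if_neg h, if_neg h', neg_neg]
  ring

/-- The expected remaining time to ruin of the symmetric correlated random walk at position `s`
whose last step was `x`. -/
def ruinPotential (p A B s x : ℝ) : ℝ :=
  -((1 - p) / p) * s ^ 2 + ((A - B) * ((1 - p) / p) - (2 * p - 1) / p * x) * s
    + (A * B * ((1 - p) / p) + (A + B) * ((2 * p - 1) / (2 * p)))
    + (2 * p - 1) * (A - B) / (2 * p) * x

lemma ruinPotential_step {p : ℝ} (hp : p ≠ 0) (A B s : ℝ) {x : ℝ} (hx : x = 1 ∨ x = -1) :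
    p * ruinPotential p A B (s + x) x + (1 - p) * ruinPotential p A B (s + -x) (-x)
      = ruinPotential p A B s x - 1 := by
  unfold ruinPotential
  rcases hx with rfl | rfl <;> field_simp <;> ring

lemma ruinPotential_upper {p : ℝ} (hp : p ≠ 0) (A B : ℝ) : ruinPotential p A B A 1 = 0 := by
  unfold ruinPotential
  field_simp
  ring

lemma ruinPotential_lower {p : ℝ} (hp : p ≠ 0) (A B : ℝ) :
    ruinPotential p A B (-B) (-1) = 0 := by
  unfold ruinPotential
  field_simp
  ring

lemma ruinPotential_start {p : ℝ} (hp : p ≠ 0) (A B : ℝ) :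
    1 + (ruinPotential p A B 1 1 + ruinPotential p A B (-1) (-1)) / 2
      = A * B * ((1 - p) / p) + (A + B) * ((2 * p - 1) / (2 * p)) := by
  unfold ruinPotential
  field_simp
  ring

lemma continuous_ruinPotential (p A B : ℝ) :
    Continuous (fun z : ℝ × ℝ => ruinPotential p A B z.1 z.2) := by
  unfold ruinPotential
  fun_prop

lemma exists_ruinPotential_bound (p A B a b : ℝ) :
    ∃ C, 0 ≤ C ∧ ∀ s ∈ Icc a b, ∀ x ∈ Icc (-1 : ℝ) 1, |ruinPotential p A B s x| ≤ C := by
  obtain ⟨C, hC⟩ := ((isCompact_Icc (a := a) (b := b)).prod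
    (isCompact_Icc (a := (-1 : ℝ)) (b := 1))).exists_bound_of_continuousOn
      (continuous_ruinPotential p A B).continuousOn
  exact ⟨max C 0, le_max_right _ _, fun s hs x hx =>
    (hC (s, x) ⟨hs, hx⟩).trans (le_max_left _ _)⟩

/-- The event that a process has not visited `A` or `-B` up to time `n`. -/
def survival {α : Type*} (S : ℕ → α → ℝ) (A B n : ℕ) : Set α :=
  {ω | ∀ k ≤ n, ¬(S k ω = (A : ℝ) ∨ S k ω = -(B : ℝ))}

section Survival

variable {α : Type*} {X S : ℕ → α → ℝ}

lemma survival_subset_of_le (S : ℕ → α → ℝ) (A B : ℕ) {m n : ℕ} (h : m ≤ n) :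
    survival S A B n ⊆ survival S A B m :=
  fun _ hω k hk => hω k (hk.trans h)

lemma sum_step (hS : ∀ n ω, S n ω = ∑ i ∈ Finset.Icc 1 n, X i ω) (n : ℕ) (ω : α) :
    S (n + 1) ω = S n ω + X (n + 1) ω := by
  rw [hS, hS, Finset.sum_Icc_succ_top (by omega)]

lemma survival_zero (hS : ∀ n ω, S n ω = ∑ i ∈ Finset.Icc 1 n, X i ω) {A B : ℕ}
    (hA : 0 < A) (hB : 0 < B) : survival S A B 0 = univ := by
  refine eq_univ_of_forall fun ω k hk => ?_
  have hA' : (0 : ℝ) < A := by exact_mod_cast hA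
  have hB' : (0 : ℝ) < B := by exact_mod_cast hB
  obtain rfl : k = 0 := by omega
  have h0 : S 0 ω = 0 := by simp [hS]
  rw [h0]
  rintro (h | h) <;> linarith

/-- Up to ruin the walk stays at integer positions strictly between the two barriers. -/
lemma exists_int_of_mem_survival (hX : ∀ n, 1 ≤ n → ∀ ω, X n ω = 1 ∨ X n ω = -1)
    (hS : ∀ n ω, S n ω = ∑ i ∈ Finset.Icc 1 n, X i ω) {A B : ℕ} (hA : 0 < A) (hB : 0 < B)
    {n : ℕ} {ω : α} (hω : ω ∈ survival S A B n) :
    ∃ z : ℤ, S n ω = z ∧ -(B : ℤ) < z ∧ z < A := by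
  induction n with
  | zero => exact ⟨0, by simp [hS], by omega, by omega⟩
  | succ n ih =>
    obtain ⟨z, hz, h1, h2⟩ := ih (survival_subset_of_le S A B (Nat.le_succ n) hω)
    have hne := hω (n + 1) le_rfl
    have hstep := sum_step hS n ω
    rw [hz] at hstep
    rcases hX (n + 1) (by omega) ω with hx | hx
    · have heq : S (n + 1) ω = ((z + 1 : ℤ) : ℝ) := by rw [hstep, hx]; push_cast; ring
      rw [heq] at hne
      have hA' : z + 1 ≠ A := fun h => hne (Or.inl (by rw [h]; simp))
      exact ⟨z + 1, heq, by omega, by omega⟩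
    · have heq : S (n + 1) ω = ((z - 1 : ℤ) : ℝ) := by rw [hstep, hx]; push_cast; ring
      rw [heq] at hne
      have hB' : z - 1 ≠ -(B : ℤ) := fun h => hne (Or.inr (by rw [h]; simp))
      exact ⟨z - 1, heq, by omega, by omega⟩

/-- The walk can only exit through the upper barrier by an up-step and through the lower barrier
by a down-step. -/
lemma exit_of_mem_survival (hX : ∀ n, 1 ≤ n → ∀ ω, X n ω = 1 ∨ X n ω = -1)
    (hS : ∀ n ω, S n ω = ∑ i ∈ Finset.Icc 1 n, X i ω) {A B : ℕ} (hA : 0 < A) (hB : 0 < B)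
    {n : ℕ} {ω : α} (hω : ω ∈ survival S A B n) (hω' : ω ∉ survival S A B (n + 1)) :
    (S (n + 1) ω = A ∧ X (n + 1) ω = 1) ∨ (S (n + 1) ω = -B ∧ X (n + 1) ω = -1) := by
  obtain ⟨z, hz, h1, h2⟩ := exists_int_of_mem_survival hX hS hA hB hω
  have h1' : -(B : ℝ) < S n ω := by rw [hz]; exact_mod_cast h1
  have h2' : S n ω < A := by rw [hz]; exact_mod_cast h2
  have hhit : S (n + 1) ω = A ∨ S (n + 1) ω = -B := by
    by_contra hne
    refine hω' fun k hk => ?_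
    rcases Nat.le_succ_iff.1 hk with hk | rfl
    · exact hω k hk
    · exact hne
  have hstep := sum_step hS n ω
  rcases hX (n + 1) (by omega) ω with hx | hx <;> rw [hx] at hstep <;>
    rcases hhit with h | h
  · exact Or.inl ⟨h, hx⟩
  · linarith
  · linarith
  · exact Or.inr ⟨h, hx⟩

lemma measurableSet_survival (hS : ∀ n ω, S n ω = ∑ i ∈ Finset.Icc 1 n, X i ω) (A B n : ℕ) :
    MeasurableSet[sigmaUpTo X n] (survival S A B n) := by
  have heq : survival S A B n = ⋂ k ∈ Iic n, (S k ⁻¹' {(A : ℝ), -(B : ℝ)})ᶜ := by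
    ext ω
    simp [survival]
  rw [heq]
  refine MeasurableSet.biInter (to_countable _) fun k hk => MeasurableSet.compl ?_
  have hSk : S k = fun ω => ∑ i ∈ Finset.Icc 1 k, X i ω := funext (hS k)
  rw [hSk]
  exact measurable_sum_sigmaUpTo X hk (by measurability)

/-- The ruin time is the number of times at which ruin has not yet happened. -/
lemma tsum_indicator_survival (A B : ℕ) {ω : α}
    (hω : ∃ n, ω ∉ survival S A B n) :
    ∑' n, (survival S A B n).indicator (fun _ => (1 : ℝ)) ω
      = (sInf {k | S k ω = (A : ℝ) ∨ S k ω = -(B : ℝ)} : ℕ) := by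
  set K := {k | S k ω = (A : ℝ) ∨ S k ω = -(B : ℝ)} with hK
  have hne : K.Nonempty := by
    obtain ⟨n, hn⟩ := hω
    by_contra hK'
    exact hn fun k _ hk => hK' ⟨k, hk⟩
  have hmem (n : ℕ) : ω ∈ survival S A B n ↔ n < sInf K := by
    refine ⟨fun h => ?_, fun h k hk hk' => ?_⟩
    · by_contra! hle
      exact h _ hle (Nat.sInf_mem hne)
    · exact absurd (Nat.sInf_le (show k ∈ K from hk')) (by omega)
  rw [tsum_eq_sum (s := Finset.range (sInf K)) fun n hn => by
    rw [indicator_of_notMem]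
    rw [hmem]
    simpa using hn]
  rw [Finset.sum_congr rfl fun n hn =>
    indicator_of_mem ((hmem n).2 (Finset.mem_range.1 hn)) (fun _ => (1 : ℝ))]
  simp

end Survival

lemma IsCRW.measurable_sum {μ : Measure Ω} {X S : ℕ → Ω → ℝ} {p q : ℝ} (hX : IsCRW μ X p q)
    (hS : ∀ n ω, S n ω = ∑ i ∈ Finset.Icc 1 n, X i ω) (n : ℕ) : Measurable (S n) := by
  have hSn : S n = fun ω => ∑ i ∈ Finset.Icc 1 n, X i ω := funext (hS n)
  rw [hSn]
  exact Finset.measurable_fun_sum _ fun i hi => hX.1 i (Finset.mem_Icc.1 hi).1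

section Ruin

variable {μ : Measure Ω} [IsProbabilityMeasure μ] {X S : ℕ → Ω → ℝ} {p : ℝ}

/-- The expected potential before ruin is controlled by the survival probability. -/
lemma exists_setIntegral_ruinPotential_bound (hX : IsCRW μ X p p)
    (hS : ∀ n ω, S n ω = ∑ i ∈ Finset.Icc 1 n, X i ω) {A B : ℕ} (hA : 0 < A) (hB : 0 < B) :
    ∃ C, 0 ≤ C ∧ ∀ n, 1 ≤ n →
      |∫ ω in survival S A B n, ruinPotential p A B (S n ω) (X n ω) ∂μ|
        ≤ C * μ.real (survival S A B n) := by
  obtain ⟨C, hC0, hC⟩ := exists_ruinPotential_bound p A B (-B) A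
  refine ⟨C, hC0, fun n hn => ?_⟩
  rw [← Real.norm_eq_abs]
  refine norm_setIntegral_le_of_norm_le_const (measure_lt_top μ _) fun ω hω => ?_
  obtain ⟨z, hz, h1, h2⟩ := exists_int_of_mem_survival hX.2.1 hS hA hB hω
  refine hC _ ⟨?_, ?_⟩ _ ?_
  · rw [hz]; exact_mod_cast h1.le
  · rw [hz]; exact_mod_cast h2.le
  · rcases hX.2.1 n hn ω with h | h <;> rw [h] <;> norm_num

lemma setIntegral_ruinPotential_succ (hX : IsCRW μ X p p) (hp0 : 0 < p) (hp1 : p ≤ 1)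
    (hS : ∀ n ω, S n ω = ∑ i ∈ Finset.Icc 1 n, X i ω) {A B : ℕ} (hA : 0 < A) (hB : 0 < B)
    {n : ℕ} (hn : 1 ≤ n) :
    ∫ ω in survival S A B (n + 1), ruinPotential p A B (S (n + 1) ω) (X (n + 1) ω) ∂μ
      = ∫ ω in survival S A B n, ruinPotential p A B (S n ω) (X n ω) ∂μ
        - μ.real (survival S A B n) := by
  have hmeas (m : ℕ) : MeasurableSet (survival S A B m) :=
    sigmaUpTo_le hX.1 m _ (measurableSet_survival hS A B m)
  have hSm := hX.measurable_sum hS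
  have hpos {ω : Ω} (hω : ω ∈ survival S A B n) : S n ω ∈ Icc (-B : ℝ) A := by
    obtain ⟨z, hz, h1, h2⟩ := exists_int_of_mem_survival hX.2.1 hS hA hB hω
    rw [hz]
    exact ⟨by exact_mod_cast h1.le, by exact_mod_cast h2.le⟩
  have hcont := continuous_ruinPotential p A B
  let f : ℝ → Ω → ℝ := fun j =>
    (survival S A B n).indicator fun ω => ruinPotential p A B (S n ω + j) j
  have hf (j : ℝ) : Measurable[sigmaUpTo X n] (f j) := by
    refine Measurable.indicator ?_ (measurableSet_survival hS A B n)
    have hSn : S n = fun ω => ∑ i ∈ Finset.Icc 1 n, X i ω := funext (hS n)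
    have hmS : Measurable[sigmaUpTo X n] (S n) := by
      rw [hSn]
      exact measurable_sum_sigmaUpTo X le_rfl
    have hc : Continuous fun s : ℝ => ruinPotential p A B (s + j) j := by
      unfold ruinPotential
      fun_prop
    exact hc.measurable.comp hmS
  have hfi (j : ℝ) : Integrable (f j) μ := by
    have hc : Continuous fun s : ℝ => ruinPotential p A B (s + j) j := by
      unfold ruinPotential
      fun_prop
    obtain ⟨C, hC⟩ := (isCompact_Icc (a := (-B : ℝ)) (b := A)).exists_bound_of_continuousOn
      hc.continuousOn
    refine (integrable_indicator_iff (hmeas n)).2 (Measure.integrableOn_of_bounded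
      (measure_ne_top μ _) (hc.measurable.comp (hSm n)).aestronglyMeasurable (M := C) ?_)
    exact (ae_restrict_mem (hmeas n)).mono fun ω hω => hC _ (hpos hω)
  have hfX : Integrable (fun ω => f (X (n + 1) ω) ω) μ := by
    refine ((hfi 1).abs.add (hfi (-1)).abs).mono' ?_ (.of_forall fun ω => ?_)
    · refine (Measurable.indicator ?_ (hmeas n)).aestronglyMeasurable
        (f := (survival S A B n).indicator fun ω =>
          ruinPotential p A B (S n ω + X (n + 1) ω) (X (n + 1) ω))
      exact hcont.measurable.comp
        (((hSm n).add (hX.1 (n + 1) (by omega))).prodMk (hX.1 (n + 1) (by omega)))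
    · rcases hX.2.1 (n + 1) (by omega) ω with h | h <;> simp [h]
  have hleft : ∫ ω in survival S A B (n + 1),
      ruinPotential p A B (S (n + 1) ω) (X (n + 1) ω) ∂μ = ∫ ω, f (X (n + 1) ω) ω ∂μ := by
    rw [← integral_indicator (hmeas (n + 1))]
    congr 1
    funext ω
    by_cases hω : ω ∈ survival S A B n
    · by_cases hω' : ω ∈ survival S A B (n + 1)
      · simp only [f, indicator_of_mem hω, indicator_of_mem hω', sum_step hS n ω]
      · simp only [f, indicator_of_mem hω, indicator_of_notMem hω', ← sum_step hS n ω]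
        rcases exit_of_mem_survival hX.2.1 hS hA hB hω hω' with ⟨h1, h2⟩ | ⟨h1, h2⟩
        · rw [h1, h2, ruinPotential_upper hp0.ne']
        · rw [h1, h2, ruinPotential_lower hp0.ne']
    · have hω' : ω ∉ survival S A B (n + 1) :=
        fun h => hω (survival_subset_of_le S A B (Nat.le_succ n) h)
      simp only [f, indicator_of_notMem hω, indicator_of_notMem hω']
  have hright : ∀ ω, p * f (X n ω) ω + (1 - p) * f (-X n ω) ω
      = (survival S A B n).indicator
          (fun ω => ruinPotential p A B (S n ω) (X n ω) - 1) ω := by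
    intro ω
    by_cases hω : ω ∈ survival S A B n
    · simp only [f, indicator_of_mem hω]
      exact ruinPotential_step hp0.ne' A B (S n ω) (hX.2.1 n hn ω)
    · simp only [f, indicator_of_notMem hω, mul_zero, add_zero]
  have hint : IntegrableOn (fun ω => ruinPotential p A B (S n ω) (X n ω))
      (survival S A B n) μ := by
    obtain ⟨C, -, hC⟩ := exists_ruinPotential_bound p A B (-B) A
    refine Measure.integrableOn_of_bounded (measure_ne_top μ _)
      (hcont.measurable.comp ((hSm n).prodMk (hX.1 n hn))).aestronglyMeasurable (M := C) ?_
    refine (ae_restrict_mem (hmeas n)).mono fun ω hω => hC _ (hpos hω) _ ?_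
    rcases hX.2.1 n hn ω with h | h <;> rw [h] <;> norm_num
  rw [hleft, hX.integral_step hp0.le hp1 hn hf hfi hfX, integral_congr_ae (.of_forall hright),
    integral_indicator (hmeas n), integral_sub hint (integrable_const _)]
  simp

lemma setIntegral_ruinPotential_one (hX : IsCRW μ X p p) (hp0 : 0 < p) (hp1 : p < 1)
    (hS : ∀ n ω, S n ω = ∑ i ∈ Finset.Icc 1 n, X i ω) {A B : ℕ} (hA : 0 < A) (hB : 0 < B) :
    ∫ ω in survival S A B 1, ruinPotential p A B (S 1 ω) (X 1 ω) ∂μ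
      = (ruinPotential p A B 1 1 + ruinPotential p A B (-1) (-1)) / 2 := by
  have hX1 := hX.1 1 le_rfl
  have hval := hX.2.1 1 le_rfl
  have hS1 (ω : Ω) : S 1 ω = X 1 ω := by simp [hS]
  have hset (i : ℝ) : MeasurableSet {ω | X 1 ω = i} := hX1 (measurableSet_singleton i)
  have hmeas : MeasurableSet (survival S A B 1) :=
    sigmaUpTo_le hX.1 1 _ (measurableSet_survival hS A B 1)
  have heq : ∀ ω, (survival S A B 1).indicator
      (fun ω => ruinPotential p A B (S 1 ω) (X 1 ω)) ω
        = ruinPotential p A B (X 1 ω) (X 1 ω) := by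
    intro ω
    by_cases hω : ω ∈ survival S A B 1
    · rw [indicator_of_mem hω, hS1]
    · rw [indicator_of_notMem hω, ← hS1]
      have h0 : ω ∈ survival S A B 0 := by simp [survival_zero hS hA hB]
      rcases exit_of_mem_survival hX.2.1 hS hA hB h0 hω with ⟨h1, h2⟩ | ⟨h1, h2⟩
      · rw [zero_add] at h1 h2
        nth_rw 2 [hS1]
        rw [h1, h2, ruinPotential_upper hp0.ne']
      · rw [zero_add] at h1 h2
        nth_rw 2 [hS1]
        rw [h1, h2, ruinPotential_lower hp0.ne']
  have hlin : ∀ ω, ruinPotential p A B (X 1 ω) (X 1 ω)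
      = {ω | X 1 ω = 1}.indicator (fun _ => ruinPotential p A B 1 1) ω
        + {ω | X 1 ω = 1}ᶜ.indicator (fun _ => ruinPotential p A B (-1) (-1)) ω := by
    intro ω
    rcases hval ω with h | h <;> norm_num [indicator, h]
  have hhalf : μ.real {ω | X 1 ω = 1} = 1 / 2 := by
    have h2 : (1 - p) / (2 - p - p) = 1 / 2 := by
      rw [div_eq_div_iff (by linarith) (by norm_num)]
      ring
    rw [measureReal_def, hX.2.2.1, h2, ENNReal.toReal_ofReal (by norm_num)]
  rw [← integral_indicator hmeas, integral_congr_ae (.of_forall heq),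
    integral_congr_ae (.of_forall hlin),
    integral_add ((integrable_const _).indicator (hset 1))
      ((integrable_const _).indicator (hset 1).compl),
    integral_indicator_const _ (hset 1), integral_indicator_const _ (hset 1).compl,
    probReal_compl_eq_one_sub (hset 1), hhalf]
  simp only [smul_eq_mul]
  ring

/-- The tail probabilities of the ruin time sum to the expected value of the potential. -/
lemma hasSum_survival (hX : IsCRW μ X p p) (hp0 : 0 < p) (hp1 : p < 1)
    (hS : ∀ n ω, S n ω = ∑ i ∈ Finset.Icc 1 n, X i ω) {A B : ℕ} (hA : 0 < A) (hB : 0 < B) :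
    HasSum (fun n => μ.real (survival S A B n))
      ((A : ℝ) * B * ((1 - p) / p) + ((A : ℝ) + B) * ((2 * p - 1) / (2 * p))) := by
  set u : ℕ → ℝ := fun n =>
    ∫ ω in survival S A B n, ruinPotential p A B (S n ω) (X n ω) ∂μ with hu
  obtain ⟨C, hC0, hC⟩ := exists_setIntegral_ruinPotential_bound hX hS hA hB
  have hsum (N : ℕ) : ∑ n ∈ Finset.range (N + 1), μ.real (survival S A B n)
      = 1 + u 1 - u (N + 1) := by
    induction N with
    | zero => simp [survival_zero hS hA hB]
    | succ N ih =>
      rw [Finset.sum_range_succ, ih]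
      have := setIntegral_ruinPotential_succ hX hp0 hp1.le hS hA hB (n := N + 1) (by omega)
      simp only [hu]
      linarith
  have hbound (N : ℕ) : ∑ n ∈ Finset.range N, μ.real (survival S A B n) ≤ 1 + u 1 + C := by
    refine (Finset.sum_le_sum_of_subset_of_nonneg (Finset.range_mono (Nat.le_succ N))
      fun _ _ _ => measureReal_nonneg).trans ?_
    rw [hsum N]
    have h1 := (abs_le.1 (hC (N + 1) (by omega))).1
    have h2 : C * μ.real (survival S A B (N + 1)) ≤ C :=
      mul_le_of_le_one_right hC0 measureReal_le_one
    simp only [hu]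
    linarith
  have hsummable : Summable fun n => μ.real (survival S A B n) :=
    summable_of_sum_range_le (fun _ => measureReal_nonneg) hbound
  have hu0 : Filter.Tendsto (fun N => u (N + 1)) Filter.atTop (nhds 0) := by
    refine squeeze_zero_norm (fun N => hC (N + 1) (by omega)) ?_
    simpa using ((Filter.tendsto_add_atTop_iff_nat 1).2
      hsummable.tendsto_atTop_zero).const_mul C
  have hlim := (Filter.tendsto_add_atTop_iff_nat 1).2 hsummable.hasSum.tendsto_sum_nat
  simp only [hsum] at hlim
  have hval := tendsto_nhds_unique hlim (hu0.const_sub (1 + u 1))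
  rw [sub_zero] at hval
  rw [← ruinPotential_start hp0.ne', ← setIntegral_ruinPotential_one hX hp0 hp1 hS hA hB,
    ← hval]
  exact hsummable.hasSum

end Ruin

/-- Expected waiting time until ruin for the symmetric two-state CRW (`p = q`),
started from the stationary distribution `(1/2, 1/2)`: with
`τ = inf{k : S_k = A or S_k = -B}`,
`E(τ) = A·B·(1-p)/p + (A+B)·(2p-1)/(2p)`. -/
theorem crw_symmetric_expected_ruin_time
    (μ : Measure Ω) [IsProbabilityMeasure μ] (X : ℕ → Ω → ℝ) (p : ℝ)
    (hp0 : 0 < p) (hp1 : p < 1) (hX : IsCRW μ X p p)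
    (A B : ℕ) (hA : 0 < A) (hB : 0 < B)
    (S : ℕ → Ω → ℝ) (hS : ∀ n ω, S n ω = ∑ i ∈ Finset.Icc 1 n, X i ω)
    (τ : Ω → ℕ)
    (hτ : ∀ ω, τ ω = sInf {k | S k ω = (A : ℝ) ∨ S k ω = -(B : ℝ)}) :
    ∫ ω, (τ ω : ℝ) ∂μ
      = (A : ℝ) * (B : ℝ) * ((1 - p) / p)
        + ((A : ℝ) + (B : ℝ)) * ((2 * p - 1) / (2 * p)) := by
  have hmeas (n : ℕ) : MeasurableSet (survival S A B n) :=
    sigmaUpTo_le hX.1 n _ (measurableSet_survival hS A B n)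
  have hsum := hasSum_survival hX hp0 hp1 hS hA hB
  have hint (n : ℕ) : ∫ ω, (survival S A B n).indicator (fun _ => (1 : ℝ)) ω ∂μ
      = μ.real (survival S A B n) := by
    rw [integral_indicator_const _ (hmeas n), smul_eq_mul, mul_one]
  have hexit : ∀ᵐ ω ∂μ, ∃ n, ω ∉ survival S A B n := by
    have hzero : μ.real (⋂ n, survival S A B n) = 0 :=
      le_antisymm (ge_of_tendsto' hsum.summable.tendsto_atTop_zero
        fun n => measureReal_mono (iInter_subset _ n)) measureReal_nonneg
    rw [measureReal_eq_zero_iff] at hzero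
    filter_upwards [measure_eq_zero_iff_ae_notMem.1 hzero] with ω hω
    simpa using hω
  have htsum := hasSum_integral_of_summable_integral_norm (μ := μ)
    (F := fun n => (survival S A B n).indicator fun _ => (1 : ℝ))
    (fun n => (integrable_const _).indicator (hmeas n)) (by
      simpa only [norm_indicator_eq_indicator_norm, norm_one, hint] using hsum.summable)
  simp only [hint] at htsum
  rw [← htsum.unique hsum]
  refine integral_congr_ae (hexit.mono fun ω hω => ?_)
  simp only [hτ, tsum_indicator_survival A B hω]
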